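/- arXiv:1010.3126 — 5 statements merged into one kernel-verified Lean document; each statement's English description precedes it below -/
import Mathlib

section
/- Let a, b, Q, W : ℝ² → ℝ be smooth functions satisfying ∂ₓQ = (b − a)·Q and ∂ₓW = Q on ℝ², and let f : ℝ → ℝ be smooth. Then for every smooth u : ℝ² → ℝ and every point (x,y) with W(x,y) + f(y) ≠ 0, setting h(x,y) = Q(x,y)/(W(x,y) + f(y)), one has the operator identity (Dₓ + a + h)((Dₓ + b − h)u) = (Dₓ + a)((Dₓ + b)u); that is, the composition of the two first-order operators Dₓ + a + Q/(W+f) and Dₓ + b − Q/(W+f) is independent of the parameter function f and equals (Dₓ + a)∘(Dₓ + b). -/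
/-- Partial derivative in the first (`x`) variable of a function on the plane. -/
noncomputable def Dx (u : ℝ → ℝ → ℝ) : ℝ → ℝ → ℝ := fun x y => deriv (fun s => u s y) x

/-- Partial derivative in the second (`y`) variable of a function on the plane. -/
noncomputable def Dy (u : ℝ → ℝ → ℝ) : ℝ → ℝ → ℝ := fun x y => deriv (fun t => u x t) y

/-- A function on the plane is smooth if it is infinitely differentiable as a function
of the pair of variables. -/
def Smooth2 (u : ℝ → ℝ → ℝ) : Prop := ContDiff ℝ (⊤ : ℕ∞) (fun p : ℝ × ℝ => u p.1 p.2)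

/-- The first-order operator `Dₓ + p`, sending `u` to `∂ₓu + p·u`. -/
noncomputable def opX (p u : ℝ → ℝ → ℝ) : ℝ → ℝ → ℝ := fun x y => Dx u x y + p x y * u x y

/-- The first-order operator `D_y + q`, sending `u` to `∂_yu + q·u`. -/
noncomputable def opY (q u : ℝ → ℝ → ℝ) : ℝ → ℝ → ℝ := fun x y => Dy u x y + q x y * u x y

/-- A smooth function on the plane is smooth in its first variable. -/
theorem Smooth2.contDiff_fst {u : ℝ → ℝ → ℝ} (hu : Smooth2 u) (y : ℝ) :
    ContDiff ℝ (⊤ : ℕ∞) (fun s => u s y) :=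
  ContDiff.comp (g := fun p : ℝ × ℝ => u p.1 p.2) (f := fun s => (s, y)) hu (by fun_prop)

theorem Smooth2.hasDerivAt_fst {u : ℝ → ℝ → ℝ} (hu : Smooth2 u) (x y : ℝ) :
    HasDerivAt (fun s => u s y) (Dx u x y) x :=
  ((hu.contDiff_fst y).differentiable (by simp) x).hasDerivAt

theorem Smooth2.hasDerivAt_Dx {u : ℝ → ℝ → ℝ} (hu : Smooth2 u) (x y : ℝ) :
    HasDerivAt (fun s => Dx u s y) (Dx (Dx u) x y) x :=
  (((contDiff_infty_iff_deriv.1 (hu.contDiff_fst y)).2).differentiable (by simp) x).hasDerivAt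

/-- The composition `(Dₓ + p)(Dₓ + q)` in expanded form. -/
theorem opX_opX {p q u : ℝ → ℝ → ℝ} {x y q' : ℝ} (hu : Smooth2 u)
    (hq : HasDerivAt (fun s => q s y) q' x) :
    opX p (opX q u) x y = Dx (Dx u) x y + (q' * u x y + q x y * Dx u x y)
      + p x y * (Dx u x y + q x y * u x y) := by
  have h : Dx (opX q u) x y = Dx (Dx u) x y + (q' * u x y + q x y * Dx u x y) :=
    ((hu.hasDerivAt_Dx x y).add (hq.mul (hu.hasDerivAt_fst x y))).deriv
  rw [opX, h, opX]

theorem stmt0 (a b Q W : ℝ → ℝ → ℝ) (f : ℝ → ℝ)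
    (ha : Smooth2 a) (hb : Smooth2 b) (hQ : Smooth2 Q) (hW : Smooth2 W)
    (hf : ContDiff ℝ (⊤ : ℕ∞) f)
    (hQx : ∀ x y, Dx Q x y = (b x y - a x y) * Q x y)
    (hWx : ∀ x y, Dx W x y = Q x y) :
    ∀ u : ℝ → ℝ → ℝ, Smooth2 u → ∀ x y : ℝ, W x y + f y ≠ 0 →
      opX (fun x y => a x y + Q x y / (W x y + f y))
          (opX (fun x y => b x y - Q x y / (W x y + f y)) u) x y
        = opX a (opX b u) x y := by
  intro u hu x y hne
  have hWd : HasDerivAt (fun s => W s y + f y) (Q x y) x := by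
    simpa only [hWx] using (hW.hasDerivAt_fst x y).add_const (f y)
  have hQd : HasDerivAt (fun s => Q s y) ((b x y - a x y) * Q x y) x := by
    simpa only [hQx] using hQ.hasDerivAt_fst x y
  have hbd := hb.hasDerivAt_fst x y
  rw [opX_opX (q := fun x y => b x y - Q x y / (W x y + f y)) hu (hbd.sub (hQd.div hWd hne)),
    opX_opX hu hbd]
  field_simp
  ring
end

section
/- Let a, b, a', b' : ℝ² → ℝ be smooth and suppose (Dₓ + a')((Dₓ + b')u) = (Dₓ + a)((Dₓ + b)u) for every smooth u : ℝ² → ℝ. Then a' + b' = a + b on ℝ², and the function g = a' − a satisfies ∂ₓg = (b − a)·g − g². -/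
theorem Smooth2.differentiableAt_left {u : ℝ → ℝ → ℝ} (hu : Smooth2 u) (x y : ℝ) :
    DifferentiableAt ℝ (fun s => u s y) x := by
  have h : ContDiff ℝ (⊤ : ℕ∞) (fun s : ℝ => u s y) :=
    ContDiff.comp (g := fun p : ℝ × ℝ => u p.1 p.2) hu (contDiff_prodMk_left y)
  exact (h.differentiable (by simp)).differentiableAt

theorem opX_opX_one (p q : ℝ → ℝ → ℝ) (x y : ℝ) :
    opX p (opX q fun _ _ => 1) x y = Dx q x y + p x y * q x y := by
  simp [opX, Dx]

theorem opX_opX_sub_const {q : ℝ → ℝ → ℝ} (hq : Smooth2 q) (p : ℝ → ℝ → ℝ) (x y : ℝ) :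
    opX p (opX q fun s _ => s - x) x y = p x y + q x y := by
  have h : HasDerivAt (fun s => q s y * (s - x)) (q x y) x := by
    simpa using (hq.differentiableAt_left x y).hasDerivAt.fun_mul
      ((hasDerivAt_id x).sub_const x)
  simp [opX, Dx, h.deriv, add_comm]

theorem stmt3 (a b a' b' : ℝ → ℝ → ℝ)
    (ha : Smooth2 a) (hb : Smooth2 b) (ha' : Smooth2 a') (hb' : Smooth2 b')
    (hfac : ∀ u : ℝ → ℝ → ℝ, Smooth2 u → ∀ x y : ℝ,
      opX a' (opX b' u) x y = opX a (opX b u) x y) :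
    (∀ x y : ℝ, a' x y + b' x y = a x y + b x y) ∧
    (∀ x y : ℝ, Dx (fun x y => a' x y - a x y) x y
        = (b x y - a x y) * (a' x y - a x y) - (a' x y - a x y) ^ 2) := by
  have hsum : ∀ x y : ℝ, a' x y + b' x y = a x y + b x y := fun x y => by
    have h := hfac (fun s _ => s - x) (contDiff_fst.sub contDiff_const) x y
    rwa [opX_opX_sub_const hb', opX_opX_sub_const hb] at h
  refine ⟨hsum, fun x y => ?_⟩
  have hone := hfac (fun _ _ => 1) contDiff_const x y
  rw [opX_opX_one, opX_opX_one] at hone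
  have hdiff : (fun x y => a' x y - a x y) = fun x y => b x y - b' x y := by
    funext s t
    linarith [hsum s t]
  have hD : Dx (fun x y => a' x y - a x y) x y = Dx b x y - Dx b' x y := by
    rw [hdiff]
    exact deriv_fun_sub (hb.differentiableAt_left x y) (hb'.differentiableAt_left x y)
  have hb'_eq : b' x y = a x y + b x y - a' x y := by linarith [hsum x y]
  rw [hb'_eq] at hone
  rw [hD]
  linear_combination -hone
end

section
/- Let a₁, b₁, a₂, b₂ : ℝ² → ℝ be smooth and suppose that for every smooth u : ℝ² → ℝ, (Dₓ + b₁)((D_y + a₁)u) = (Dₓ + b₂)((D_y + a₂)u) on ℝ². Then a₁ = a₂ and b₁ = b₂. -/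
/-- A smooth function on the plane is differentiable along horizontal lines. -/
theorem Smooth2.differentiable_left {u : ℝ → ℝ → ℝ} (hu : Smooth2 u) (y : ℝ) :
    Differentiable ℝ (fun s => u s y) := by
  have h : Differentiable ℝ (fun p : ℝ × ℝ => u p.1 p.2) := ContDiff.differentiable hu (by simp)
  exact h.comp (f := fun s : ℝ => (s, y)) (by fun_prop)

/-- Testing `(Dₓ + b)(D_y + a)` on `x - x₀` recovers the value of `a`. -/
theorem opX_opY_sub_fst {a : ℝ → ℝ → ℝ} (b : ℝ → ℝ → ℝ) (ha : Smooth2 a) (x y : ℝ) :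
    opX b (opY a (fun s _ => s - x)) x y = a x y := by
  have h : HasDerivAt (fun s => a s y * (s - x)) (a x y) x := by
    simpa using (ha.differentiable_left y x).hasDerivAt.fun_mul ((hasDerivAt_id x).sub_const x)
  simp [opX, opY, Dx, Dy, h.deriv]

/-- Testing `(Dₓ + b)(D_y + a)` on `y - y₀` recovers the value of `b`. -/
theorem opX_opY_sub_snd (a b : ℝ → ℝ → ℝ) (x y : ℝ) :
    opX b (opY a (fun _ t => t - y)) x y = b x y := by
  simp [opX, opY, Dx, Dy]

theorem stmt5 (a₁ b₁ a₂ b₂ : ℝ → ℝ → ℝ)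
    (ha₁ : Smooth2 a₁) (hb₁ : Smooth2 b₁) (ha₂ : Smooth2 a₂) (hb₂ : Smooth2 b₂)
    (hfac : ∀ u : ℝ → ℝ → ℝ, Smooth2 u → ∀ x y : ℝ,
      opX b₁ (opY a₁ u) x y = opX b₂ (opY a₂ u) x y) :
    a₁ = a₂ ∧ b₁ = b₂ := by
  constructor
  · funext x y
    have hu : Smooth2 (fun s _ => s - x) := contDiff_fst.sub contDiff_const
    simpa only [opX_opY_sub_fst _ ha₁, opX_opY_sub_fst _ ha₂] using hfac _ hu x y
  · funext x y
    have hu : Smooth2 (fun _ t => t - y) := contDiff_snd.sub contDiff_const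
    simpa only [opX_opY_sub_snd] using hfac _ hu x y
end

section
/- Let r, b, r̃, ã, b̃, c̃ : ℝ² → ℝ be smooth, and suppose that for every smooth u : ℝ² → ℝ, (Dₓ + r̃)((D_{xy} + ã·Dₓ + b̃·D_y + c̃)u) = (Dₓ + r)((Dₓ + b)(∂_y u)) on ℝ². Then ã = 0 and c̃ = 0, and moreover b̃ + r̃ = b + r. Consequently the second factor equals (Dₓ + b̃)∘D_y, so every factorization of type (X)(XY) of the operator (Dₓ + r)∘(Dₓ + b)∘D_y splits further and any family of factorizations of type (X)(XY) of such an operator is reducible. -/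
/-- A smooth function on the plane is differentiable in the first variable. -/
lemma Smooth2.differentiableAt_fst {f : ℝ → ℝ → ℝ} (hf : Smooth2 f) (x y : ℝ) :
    DifferentiableAt ℝ (fun s => f s y) x := by
  have h : Differentiable ℝ (fun p : ℝ × ℝ => f p.1 p.2) := ContDiff.differentiable hf (by simp)
  exact (h (x, y)).comp (f := fun s : ℝ => (s, y)) x (by fun_prop)

lemma deriv_const_add_mul_sub {g : ℝ → ℝ} {x : ℝ} (hg : DifferentiableAt ℝ g x) (k : ℝ) :
    deriv (fun s => k + g s * (s - x)) x = g x := by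
  have h := (hg.hasDerivAt.mul ((hasDerivAt_id x).sub_const x)).const_add k
  simpa using h.deriv

/-- Here `rt`, `at'`, `bt`, `ct` play the roles of `r̃`, `ã`, `b̃`, `c̃`. -/
theorem stmt12 (r b rt at' bt ct : ℝ → ℝ → ℝ)
    (hr : Smooth2 r) (hb : Smooth2 b) (hrt : Smooth2 rt)
    (hat : Smooth2 at') (hbt : Smooth2 bt) (hct : Smooth2 ct)
    (hfac : ∀ u : ℝ → ℝ → ℝ, Smooth2 u → ∀ x y : ℝ,
      opX rt (fun x y => Dx (Dy u) x y + at' x y * Dx u x y + bt x y * Dy u x y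
          + ct x y * u x y) x y
        = opX r (opX b (Dy u)) x y) :
    (∀ x y : ℝ, at' x y = 0) ∧ (∀ x y : ℝ, ct x y = 0) ∧
    (∀ x y : ℝ, bt x y + rt x y = b x y + r x y) := by
  have hat0 : ∀ x y : ℝ, at' x y = 0 := by
    intro x y
    have h := hfac (fun s _ => (s - x) ^ 2) (by unfold Smooth2; fun_prop) x y
    have hd : DifferentiableAt ℝ (fun s => at' s y * 2 + ct s y * (s - x)) x := by
      have h1 := hat.differentiableAt_fst x y
      have h2 := hct.differentiableAt_fst x y
      fun_prop
    have e := deriv_const_add_mul_sub hd 0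
    have hx : ∀ s : ℝ, deriv (fun t : ℝ => (t - x) ^ 2) s = 2 * (s - x) := fun s => by
      simp
    have e' : deriv (fun s => at' s y * (2 * (s - x)) + ct s y * (s - x) ^ 2) x
        = at' x y * 2 := by
      have : (fun s => at' s y * (2 * (s - x)) + ct s y * (s - x) ^ 2)
          = fun s => 0 + (at' s y * 2 + ct s y * (s - x)) * (s - x) := by
        funext s; ring
      rw [this, e]; ring
    simp only [opX, Dx, Dy, deriv_const, hx] at h
    simp only [deriv_const, mul_zero, zero_add, add_zero, e'] at h
    simpa using h
  have hct0 : ∀ x y : ℝ, ct x y = 0 := by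
    intro x y
    have h := hfac (fun s _ => s - x) (by unfold Smooth2; fun_prop) x y
    have e := deriv_const_add_mul_sub (hct.differentiableAt_fst x y) 0
    simp only [zero_add] at e
    simpa [opX, Dx, Dy, hat0, e] using h
  refine ⟨hat0, hct0, fun x y => ?_⟩
  have h := hfac (fun s t => (s - x) * (t - y)) (by unfold Smooth2; fun_prop) x y
  have e1 := deriv_const_add_mul_sub (hbt.differentiableAt_fst x y) 1
  have e2 := deriv_const_add_mul_sub (hb.differentiableAt_fst x y) 1
  simpa [opX, Dx, Dy, hat0, hct0, e1, e2] using h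
end

section
/- Let α, β ∈ ℝ with α ≠ 0 and β ≠ 0, and set w(x,y) = y + αx + β. Then for every smooth u : ℝ² → ℝ and every point (x,y) with w(x,y) ≠ 0, applying successively the operators C : u ↦ ∂ₓ∂_yu − (1/w)·∂ₓu − (α/w)·∂_yu, then B : v ↦ ∂_yv + (1/w)·v, then A : z ↦ ∂ₓz + (α/w)·z, yields A(B(C(u))) = ∂ₓ∂ₓ∂_y∂_y u. That is, D_{xxyy} = (Dₓ + α/(y+αx+β))∘(D_y + 1/(y+αx+β))∘(D_{xy} − (1/(y+αx+β))(Dₓ + α·D_y)) for all values of the parameters α, β. -/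
namespace Smooth2

variable {u : ℝ → ℝ → ℝ}

lemma differentiableAt (hu : Smooth2 u) (p : ℝ × ℝ) :
    DifferentiableAt ℝ (fun p : ℝ × ℝ => u p.1 p.2) p :=
  (ContDiff.differentiable hu (by simp)).differentiableAt

lemma hasDerivAt_fderiv_fst (hu : Smooth2 u) (x y : ℝ) :
    HasDerivAt (fun s => u s y) (fderiv ℝ (fun p : ℝ × ℝ => u p.1 p.2) (x, y) (1, 0)) x :=
  (hu.differentiableAt (x, y)).hasFDerivAt.comp_hasDerivAt (f := fun s => (s, y)) x
    ((hasDerivAt_id x).prodMk (hasDerivAt_const x y))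

lemma hasDerivAt_fderiv_snd (hu : Smooth2 u) (x y : ℝ) :
    HasDerivAt (fun t => u x t) (fderiv ℝ (fun p : ℝ × ℝ => u p.1 p.2) (x, y) (0, 1)) y :=
  (hu.differentiableAt (x, y)).hasFDerivAt.comp_hasDerivAt y
    ((hasDerivAt_const y x).prodMk (hasDerivAt_id y))

lemma Dx_eq_fderiv (hu : Smooth2 u) (x y : ℝ) :
    Dx u x y = fderiv ℝ (fun p : ℝ × ℝ => u p.1 p.2) (x, y) (1, 0) :=
  (hu.hasDerivAt_fderiv_fst x y).deriv

lemma Dy_eq_fderiv (hu : Smooth2 u) (x y : ℝ) :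
    Dy u x y = fderiv ℝ (fun p : ℝ × ℝ => u p.1 p.2) (x, y) (0, 1) :=
  (hu.hasDerivAt_fderiv_snd x y).deriv

lemma hasDerivAt_Dx_s14 (hu : Smooth2 u) (x y : ℝ) :
    HasDerivAt (fun s => u s y) (Dx u x y) x :=
  (hu.hasDerivAt_fderiv_fst x y).differentiableAt.hasDerivAt

lemma hasDerivAt_Dy (hu : Smooth2 u) (x y : ℝ) :
    HasDerivAt (fun t => u x t) (Dy u x y) y :=
  (hu.hasDerivAt_fderiv_snd x y).differentiableAt.hasDerivAt

lemma contDiff_fderiv (hu : Smooth2 u) :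
    ContDiff ℝ (⊤ : ℕ∞) (fderiv ℝ (fun p : ℝ × ℝ => u p.1 p.2)) :=
  ContDiff.fderiv_right hu (by simp)

lemma smooth2_Dx (hu : Smooth2 u) : Smooth2 (Dx u) := by
  simpa only [Smooth2, hu.Dx_eq_fderiv] using hu.contDiff_fderiv.clm_apply contDiff_const

lemma smooth2_Dy (hu : Smooth2 u) : Smooth2 (Dy u) := by
  simpa only [Smooth2, hu.Dy_eq_fderiv] using hu.contDiff_fderiv.clm_apply contDiff_const

lemma Dy_Dx (hu : Smooth2 u) (x y : ℝ) : Dy (Dx u) x y = Dx (Dy u) x y := by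
  have hd : DifferentiableAt ℝ (fderiv ℝ (fun p : ℝ × ℝ => u p.1 p.2)) (x, y) :=
    (hu.contDiff_fderiv.differentiable (by simp)).differentiableAt
  rw [hu.smooth2_Dx.Dy_eq_fderiv, hu.smooth2_Dy.Dx_eq_fderiv]
  simp only [hu.Dx_eq_fderiv, hu.Dy_eq_fderiv]
  rw [fderiv_clm_apply hd (by fun_prop), fderiv_clm_apply hd (by fun_prop)]
  have htwo : minSmoothness ℝ 2 ≤ ((⊤ : ℕ∞) : WithTop ℕ∞) := by
    rw [minSmoothness_of_isRCLikeNormedField]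
    exact WithTop.coe_le_coe.2 (le_top : (2 : ℕ∞) ≤ ⊤)
  simpa using (ContDiff.contDiffAt hu).isSymmSndFDerivAt htwo (0, 1) (1, 0)

end Smooth2

/-- The composite of the two right factors, `D_y + 1/w` after
`D_{xy} - (1/w)(Dₓ + α D_y)`, is `D_{xyy} - (α/w) D_{yy}`. -/
lemma opY_comp_eq {u : ℝ → ℝ → ℝ} (hu : Smooth2 u) (α β x y : ℝ) (hw : y + α * x + β ≠ 0) :
    opY (fun x y => 1 / (y + α * x + β))
        (fun x y => Dx (Dy u) x y
          - (1 / (y + α * x + β)) * Dx u x y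
          - (α / (y + α * x + β)) * Dy u x y) x y
      = Dx (Dy (Dy u)) x y - α / (y + α * x + β) * Dy (Dy u) x y := by
  have hlin : HasDerivAt (fun t => t + α * x + β) 1 y :=
    ((hasDerivAt_id y).add_const (α * x)).add_const β
  have h := (((hu.smooth2_Dy.smooth2_Dx.hasDerivAt_Dy x y).sub
    (((hasDerivAt_const y (1 : ℝ)).fun_div hlin hw).mul (hu.smooth2_Dx.hasDerivAt_Dy x y))).sub
    (((hasDerivAt_const y α).fun_div hlin hw).mul (hu.smooth2_Dy.hasDerivAt_Dy x y))).deriv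
  rw [hu.Dy_Dx, hu.smooth2_Dy.Dy_Dx] at h
  refine (congrArg (· + _) h).trans ?_
  field_simp
  ring

theorem stmt14 (α β : ℝ) (hα : α ≠ 0) (hβ : β ≠ 0) :
    ∀ u : ℝ → ℝ → ℝ, Smooth2 u → ∀ x y : ℝ, y + α * x + β ≠ 0 →
      opX (fun x y => α / (y + α * x + β))
          (opY (fun x y => 1 / (y + α * x + β))
            (fun x y => Dx (Dy u) x y
              - (1 / (y + α * x + β)) * Dx u x y
              - (α / (y + α * x + β)) * Dy u x y)) x y
        = Dx (Dx (Dy (Dy u))) x y := by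
  intro u hu x y hw
  have hlin : HasDerivAt (fun s => y + α * s + β) α x := by
    simpa using (((hasDerivAt_id x).const_mul α).const_add y).add_const β
  have hev : ∀ᶠ s in nhds x, y + α * s + β ≠ 0 := hlin.continuousAt.eventually_ne hw
  have h := (hu.smooth2_Dy.smooth2_Dy.smooth2_Dx.hasDerivAt_Dx_s14 x y).sub
    (((hasDerivAt_const x α).fun_div hlin hw).mul (hu.smooth2_Dy.smooth2_Dy.hasDerivAt_Dx_s14 x y))
  have hD := (h.congr_of_eventuallyEq
    (hev.mono fun s hs => opY_comp_eq hu α β s y hs)).deriv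
  rw [opX, opY_comp_eq hu α β x y hw]
  refine (congrArg (· + _) hD).trans ?_
  field_simp
  ring
end
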